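/- Suppose Assumption 1 holds, only D is mismeasured (Z'=Z and Y'=Y almost surely), the measurement error of D is non-differential with respect to the potential values (D' is independent of (Z, Y_1, Y_0, D_1, D_0) given D), all conditioning events have positive probability, P(U=u) > 0 for u=a,n,c, r_D > 0, RD_{Y|Z} > 0 (so that CACE' := RD_{Y|Z}/RD_{D'|Z} ≥ 0). Define M_D = max{ P(D'=1|Z=0), P(D'=1|Z=1), P(D'=1|Y=0,Z=1), P(D'=1|Y=1,Z=1), RD_{(1−Y)D'|(1−Z)}/RD_{Y|Z} }, N_D = min{ P(D'=1|Z=0), P(D'=1|Z=1), P(D'=1|Y=0,Z=0), P(D'=1|Y=1,Z=0), RD_{YD'|Z}/RD_{Y|Z} }, U_D = min{ 1, RD_{YD'|Z}/RD_{Y|Z} }, V_D = max{ 0, RD_{(1−Y)D'|(1−Z)}/RD_{Y|Z} }. Then M_D ≤ SN_D ≤ U_D, 1 − N_D ≤ SP_D ≤ 1 − V_D, and CACE' × (M_D − N_D) ≤ CACE ≤ CACE' × (U_D − V_D), where CACE = E(Y_1 − Y_0 | U=c). -/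

import Mathlib

open MeasureTheory ProbabilityTheory

noncomputable def pr {Ω : Type*} [MeasurableSpace Ω] (μ : MeasureTheory.Measure Ω)
    (A : Set Ω) : ℝ := (μ A).toReal

noncomputable def cpr {Ω : Type*} [MeasurableSpace Ω] (μ : MeasureTheory.Measure Ω)
    (B A : Set Ω) : ℝ := (ProbabilityTheory.cond μ B A).toReal

def bin01 : Set ℝ := {0, 1}

section Auxiliary

variable {Ω : Type*} [MeasurableSpace Ω] {μ : MeasureTheory.Measure Ω}

lemma cpr_eq_div {B : Set Ω} (hB : MeasurableSet B) (A : Set Ω) :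
    cpr μ B A = μ.real (B ∩ A) / μ.real B := by
  rw [cpr, ProbabilityTheory.cond_apply hB, ENNReal.toReal_mul, ENNReal.toReal_inv,
    div_eq_inv_mul]
  rfl

lemma measurableSet_eq_level {f : Ω → ℝ} (hf : Measurable f) (x : ℝ) :
    MeasurableSet {ω | f ω = x} :=
  hf (measurableSet_singleton x)

lemma measureReal_split_binary [IsFiniteMeasure μ] {f : Ω → ℝ} (hf : Measurable f)
    (hb : ∀ ω, f ω = 0 ∨ f ω = 1) (S : Set Ω) :
    μ.real S = μ.real (S ∩ {ω | f ω = 0}) + μ.real (S ∩ {ω | f ω = 1}) := by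
  rw [← measureReal_inter_add_sdiff (s := S) (measurableSet_eq_level hf 0)]
  congr 2
  ext ω
  rcases hb ω with h | h <;> simp [h]

/-- A proportionality `μ (S ∩ E) = c * μ S` may be checked on the two levels of a binary
variable. -/
lemma measureReal_inter_eq_mul_of_binary [IsFiniteMeasure μ] {f : Ω → ℝ} (hf : Measurable f)
    (hb : ∀ ω, f ω = 0 ∨ f ω = 1) {S E : Set Ω} {c : ℝ}
    (h : ∀ x ∈ bin01, μ.real (S ∩ {ω | f ω = x} ∩ E) = c * μ.real (S ∩ {ω | f ω = x})) :
    μ.real (S ∩ E) = c * μ.real S := by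
  rw [measureReal_split_binary hf hb (S ∩ E), measureReal_split_binary hf hb S, mul_add,
    ← h 0 (by simp [bin01]), ← h 1 (by simp [bin01]), Set.inter_right_comm S E,
    Set.inter_right_comm S E]

lemma integral_binary [IsFiniteMeasure μ] {f : Ω → ℝ} (hf : Measurable f)
    (hb : ∀ ω, f ω = 0 ∨ f ω = 1) :
    Integrable f μ ∧ ∫ ω, f ω ∂μ = μ.real {ω | f ω = 1} := by
  have hf' : f = {ω | f ω = 1}.indicator 1 := by
    ext ω
    rcases hb ω with h | h <;> simp [h]
  have hm := measurableSet_eq_level hf 1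
  constructor
  · rw [hf']
    exact (integrable_const (1 : ℝ)).indicator hm
  · conv_lhs => rw [hf']
    exact integral_indicator_one hm

lemma convexCombination_mem_Icc {s q A B : ℝ} (hqs : q ≤ s) (hA : 0 ≤ A) (hB : 0 ≤ B)
    (hAB : 0 < A + B) : q ≤ (s * A + q * B) / (A + B) ∧ (s * A + q * B) / (A + B) ≤ s := by
  rw [le_div_iff₀ hAB, div_le_iff₀ hAB]
  constructor <;> nlinarith

end Auxiliary

set_option maxHeartbeats 1000000 in
theorem stmt9 {Ω : Type*} [MeasurableSpace Ω]
    (μ : MeasureTheory.Measure Ω) [IsProbabilityMeasure μ]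
    (Z D Y D' D1 D0 Y1 Y0 : Ω → ℝ)
    (h_meas_Z : Measurable Z)
    (h_meas_D : Measurable D)
    (h_meas_Y : Measurable Y)
    (h_meas_Dp : Measurable D')
    (h_meas_D1 : Measurable D1)
    (h_meas_D0 : Measurable D0)
    (h_meas_Y1 : Measurable Y1)
    (h_meas_Y0 : Measurable Y0)
    (h_bin_Z : ∀ ω, Z ω = 0 ∨ Z ω = 1)
    (h_bin_Dp : ∀ ω, D' ω = 0 ∨ D' ω = 1)
    (h_bin_D1 : ∀ ω, D1 ω = 0 ∨ D1 ω = 1)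
    (h_bin_D0 : ∀ ω, D0 ω = 0 ∨ D0 ω = 1)
    (h_bin_Y1 : ∀ ω, Y1 ω = 0 ∨ Y1 ω = 1)
    (h_bin_Y0 : ∀ ω, Y0 ω = 0 ∨ Y0 ω = 1)
    (h_consD : ∀ ω, D ω = Z ω * D1 ω + (1 - Z ω) * D0 ω)
    (h_consY : ∀ ω, Y ω = Z ω * Y1 ω + (1 - Z ω) * Y0 ω)
    (h_indep : IndepFun Z (fun ω => (Y1 ω, Y0 ω, D1 ω, D0 ω)) μ)
    (h_mono : ∀ᵐ ω ∂μ, D0 ω ≤ D1 ω)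
    (h_exclA : cpr μ {ω | D1 ω = 1 ∧ D0 ω = 1} {ω | Y1 ω = 1}
        = cpr μ {ω | D1 ω = 1 ∧ D0 ω = 1} {ω | Y0 ω = 1})
    (h_exclN : cpr μ {ω | D1 ω = 0 ∧ D0 ω = 0} {ω | Y1 ω = 1}
        = cpr μ {ω | D1 ω = 0 ∧ D0 ω = 0} {ω | Y0 ω = 1})
    (h_ndD : ∀ d ∈ bin01, ∀ d' ∈ bin01, ∀ z ∈ bin01, ∀ d1 ∈ bin01, ∀ d0 ∈ bin01, ∀ y1 ∈ bin01, ∀ y0 ∈ bin01,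
      μ ({ω | D ω = d} ∩ {ω | Z ω = z} ∩ {ω | D1 ω = d1} ∩ {ω | D0 ω = d0} ∩ {ω | Y1 ω = y1} ∩ {ω | Y0 ω = y0}) ≠ 0 →
      cpr μ ({ω | D ω = d} ∩ {ω | Z ω = z} ∩ {ω | D1 ω = d1} ∩ {ω | D0 ω = d0} ∩ {ω | Y1 ω = y1} ∩ {ω | Y0 ω = y0}) {ω | D' ω = d'}
        = cpr μ {ω | D ω = d} {ω | D' ω = d'})
    (h_posZ : ∀ z ∈ bin01, μ {ω | Z ω = z} ≠ 0)
    (h_posD : ∀ d ∈ bin01, μ {ω | D ω = d} ≠ 0)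
    (h_posYZ : ∀ y ∈ bin01, ∀ z ∈ bin01,
      μ ({ω | Y ω = y} ∩ {ω | Z ω = z}) ≠ 0)
    (h_Ua : 0 < pr μ {ω | D1 ω = 1 ∧ D0 ω = 1})
    (h_Un : 0 < pr μ {ω | D1 ω = 0 ∧ D0 ω = 0})
    (h_Uc : 0 < pr μ {ω | D1 ω = 1 ∧ D0 ω = 0})
    (SND SPD : ℝ)
    (h_SND : SND = cpr μ {ω | D ω = 1} {ω | D' ω = 1})
    (h_SPD : SPD = cpr μ {ω | D ω = 0} {ω | D' ω = 0})
    (h_rD : 0 < SND + SPD - 1)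
    (h_RDY : 0 < (cpr μ {ω | Z ω = 1} {ω | Y ω = 1} - cpr μ {ω | Z ω = 0} {ω | Y ω = 1}))
    (CACE CACE' MD ND UD VD : ℝ)
    (h_CACE : CACE = ∫ ω, (Y1 ω - Y0 ω) ∂(ProbabilityTheory.cond μ {ω | D1 ω = 1 ∧ D0 ω = 0}))
    (h_CACE' : CACE' = (cpr μ {ω | Z ω = 1} {ω | Y ω = 1} - cpr μ {ω | Z ω = 0} {ω | Y ω = 1}) / (cpr μ {ω | Z ω = 1} {ω | D' ω = 1} - cpr μ {ω | Z ω = 0} {ω | D' ω = 1}))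
    (h_MD : MD = max (cpr μ {ω | Z ω = 0} {ω | D' ω = 1}) (max (cpr μ {ω | Z ω = 1} {ω | D' ω = 1})
        (max (cpr μ ({ω | Y ω = 0} ∩ {ω | Z ω = 1}) {ω | D' ω = 1}) (max (cpr μ ({ω | Y ω = 1} ∩ {ω | Z ω = 1}) {ω | D' ω = 1})
          ((cpr μ {ω | Z ω = 0} ({ω | Y ω = 0} ∩ {ω | D' ω = 1}) - cpr μ {ω | Z ω = 1} ({ω | Y ω = 0} ∩ {ω | D' ω = 1})) / (cpr μ {ω | Z ω = 1} {ω | Y ω = 1} - cpr μ {ω | Z ω = 0} {ω | Y ω = 1}))))))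
    (h_ND : ND = min (cpr μ {ω | Z ω = 0} {ω | D' ω = 1}) (min (cpr μ {ω | Z ω = 1} {ω | D' ω = 1})
        (min (cpr μ ({ω | Y ω = 0} ∩ {ω | Z ω = 0}) {ω | D' ω = 1}) (min (cpr μ ({ω | Y ω = 1} ∩ {ω | Z ω = 0}) {ω | D' ω = 1})
          ((cpr μ {ω | Z ω = 1} ({ω | Y ω = 1} ∩ {ω | D' ω = 1}) - cpr μ {ω | Z ω = 0} ({ω | Y ω = 1} ∩ {ω | D' ω = 1})) / (cpr μ {ω | Z ω = 1} {ω | Y ω = 1} - cpr μ {ω | Z ω = 0} {ω | Y ω = 1}))))))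
    (h_UD : UD = min 1 ((cpr μ {ω | Z ω = 1} ({ω | Y ω = 1} ∩ {ω | D' ω = 1}) - cpr μ {ω | Z ω = 0} ({ω | Y ω = 1} ∩ {ω | D' ω = 1})) / (cpr μ {ω | Z ω = 1} {ω | Y ω = 1} - cpr μ {ω | Z ω = 0} {ω | Y ω = 1})))
    (h_VD : VD = max 0 ((cpr μ {ω | Z ω = 0} ({ω | Y ω = 0} ∩ {ω | D' ω = 1}) - cpr μ {ω | Z ω = 1} ({ω | Y ω = 0} ∩ {ω | D' ω = 1})) / (cpr μ {ω | Z ω = 1} {ω | Y ω = 1} - cpr μ {ω | Z ω = 0} {ω | Y ω = 1}))) :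
    MD ≤ SND ∧ SND ≤ UD ∧ 1 - ND ≤ SPD ∧ SPD ≤ 1 - VD
    ∧ CACE' * (MD - ND) ≤ CACE ∧ CACE ≤ CACE' * (UD - VD) := by
  have z0 : (0 : ℝ) ∈ bin01 := by simp [bin01]
  have z1 : (1 : ℝ) ∈ bin01 := by simp [bin01]
  have h_bin_D : ∀ ω, D ω = 0 ∨ D ω = 1 := fun ω => by
    rcases h_bin_Z ω with h | h <;> simp [h_consD, h, h_bin_D1 ω, h_bin_D0 ω]
  have h_bin_Y : ∀ ω, Y ω = 0 ∨ Y ω = 1 := fun ω => by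
    rcases h_bin_Z ω with h | h <;> simp [h_consY, h, h_bin_Y1 ω, h_bin_Y0 ω]
  have mZ := measurableSet_eq_level h_meas_Z
  have mD := measurableSet_eq_level h_meas_D
  have mY := measurableSet_eq_level h_meas_Y
  have mD1 := measurableSet_eq_level h_meas_D1
  have mD0 := measurableSet_eq_level h_meas_D0
  have mY1 := measurableSet_eq_level h_meas_Y1
  have mY0 := measurableSet_eq_level h_meas_Y0
  have hpos : ∀ {S : Set Ω}, μ S ≠ 0 → 0 < μ.real S := fun hS =>
    measureReal_nonneg.lt_of_ne' ((measureReal_ne_zero_iff).2 hS)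
  -- Misclassification acts proportionally on every cell of `(Z, Y, D)`.
  have hmis : ∀ d ∈ bin01, ∀ z ∈ bin01, ∀ y : ℝ,
      μ.real ({ω | Z ω = z} ∩ {ω | Y ω = y} ∩ {ω | D ω = d} ∩ {ω | D' ω = 1})
        = cpr μ {ω | D ω = d} {ω | D' ω = 1}
          * μ.real ({ω | Z ω = z} ∩ {ω | Y ω = y} ∩ {ω | D ω = d}) := by
    intro d hd z hz y
    refine measureReal_inter_eq_mul_of_binary h_meas_D1 h_bin_D1 fun d1 hd1 => ?_
    refine measureReal_inter_eq_mul_of_binary h_meas_D0 h_bin_D0 fun d0 hd0 => ?_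
    refine measureReal_inter_eq_mul_of_binary h_meas_Y1 h_bin_Y1 fun y1 hy1 => ?_
    refine measureReal_inter_eq_mul_of_binary h_meas_Y0 h_bin_Y0 fun y0 hy0 => ?_
    have hcell := h_ndD d hd 1 z1 z hz d1 hd1 d0 hd0 y1 hy1 y0 hy0
    set C := {ω | D ω = d} ∩ {ω | Z ω = z} ∩ {ω | D1 ω = d1} ∩ {ω | D0 ω = d0}
      ∩ {ω | Y1 ω = y1} ∩ {ω | Y0 ω = y0} with hC
    have mC : MeasurableSet C :=
      ((((((mD d).inter (mZ z)).inter (mD1 d1)).inter (mD0 d0)).inter (mY1 y1)).inter (mY0 y0))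
    by_cases hy : y = z * y1 + (1 - z) * y0
    · have hS : {ω | Z ω = z} ∩ {ω | Y ω = y} ∩ {ω | D ω = d} ∩ {ω | D1 ω = d1}
          ∩ {ω | D0 ω = d0} ∩ {ω | Y1 ω = y1} ∩ {ω | Y0 ω = y0} = C := by
        ext ω
        simp only [hC, Set.mem_inter_iff, Set.mem_ofPred_eq]
        constructor
        · tauto
        · rintro ⟨⟨⟨⟨⟨h1, h2⟩, h3⟩, h4⟩, h5⟩, h6⟩
          have := h_consY ω
          rw [h2, h5, h6, ← hy] at this
          tauto
      rw [hS]
      by_cases h0 : μ C = 0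
      · have h0' : μ.real C = 0 := (measureReal_eq_zero_iff).2 h0
        rw [h0', mul_zero]
        exact (measureReal_eq_zero_iff).2 (measure_mono_null Set.inter_subset_left h0)
      · rw [← hcell h0, cpr_eq_div mC, div_mul_cancel₀ _ (hpos h0).ne']
    · have hS : {ω | Z ω = z} ∩ {ω | Y ω = y} ∩ {ω | D ω = d} ∩ {ω | D1 ω = d1}
          ∩ {ω | D0 ω = d0} ∩ {ω | Y1 ω = y1} ∩ {ω | Y0 ω = y0} = ∅ := by
        ext ω
        simp only [Set.mem_inter_iff, Set.mem_ofPred_eq, Set.mem_empty_iff_false, iff_false]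
        rintro ⟨⟨⟨⟨⟨⟨h2, h1⟩, -⟩, h3⟩, h4⟩, h5⟩, h6⟩
        have := h_consY ω
        rw [h1, h2, h5, h6] at this
        exact hy this
      simp [hS]
  have hprodZ1 : ∀ y d : ℝ, μ.real ({ω | Z ω = 1} ∩ {ω | Y ω = y} ∩ {ω | D ω = d})
      = μ.real {ω | Z ω = 1} * μ.real ({ω | Y1 ω = y} ∩ {ω | D1 ω = d}) := by
    intro y d
    have h := h_indep.measure_inter_preimage_eq_mul {1} {p | p.1 = y ∧ p.2.2.1 = d}
      (measurableSet_singleton _)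
      ((measurableSet_eq_level measurable_fst y).inter
        (measurableSet_eq_level (measurable_fst.comp (measurable_snd.comp measurable_snd)) d))
    have hS : {ω | Z ω = 1} ∩ {ω | Y ω = y} ∩ {ω | D ω = d}
        = Z ⁻¹' {1} ∩ (fun ω => (Y1 ω, Y0 ω, D1 ω, D0 ω)) ⁻¹' {p | p.1 = y ∧ p.2.2.1 = d} := by
      ext ω
      simp only [Set.mem_inter_iff, Set.mem_ofPred_eq, Set.mem_preimage, Set.mem_singleton_iff,
        and_assoc]
      refine and_congr_right fun hz => ?_
      simp [h_consY, h_consD, hz]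
    rw [hS, Measure.real, h, ENNReal.toReal_mul]
    rfl
  have hprodZ0 : ∀ y d : ℝ, μ.real ({ω | Z ω = 0} ∩ {ω | Y ω = y} ∩ {ω | D ω = d})
      = μ.real {ω | Z ω = 0} * μ.real ({ω | Y0 ω = y} ∩ {ω | D0 ω = d}) := by
    intro y d
    have h := h_indep.measure_inter_preimage_eq_mul {0} {p | p.2.1 = y ∧ p.2.2.2 = d}
      (measurableSet_singleton _)
      ((measurableSet_eq_level (measurable_fst.comp measurable_snd) y).inter
        (measurableSet_eq_level (measurable_snd.comp (measurable_snd.comp measurable_snd)) d))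
    have hS : {ω | Z ω = 0} ∩ {ω | Y ω = y} ∩ {ω | D ω = d}
        = Z ⁻¹' {0} ∩ (fun ω => (Y1 ω, Y0 ω, D1 ω, D0 ω)) ⁻¹' {p | p.2.1 = y ∧ p.2.2.2 = d} := by
      ext ω
      simp only [Set.mem_inter_iff, Set.mem_ofPred_eq, Set.mem_preimage, Set.mem_singleton_iff,
        and_assoc]
      refine and_congr_right fun hz => ?_
      simp [h_consY, h_consD, hz]
    rw [hS, Measure.real, h, ENNReal.toReal_mul]
    rfl
  -- Stratum decomposition of the observable cells.
  have hdef : ∀ S : Set Ω, μ.real (S ∩ {ω | D1 ω = 0 ∧ D0 ω = 1}) = 0 := by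
    intro S
    refine (measureReal_eq_zero_iff).2 (measure_mono_null Set.inter_subset_right ?_)
    refine measure_mono_null ?_ (ae_iff.1 h_mono)
    rintro ω ⟨h1, h0⟩
    simp [h1, h0]
  have hset : ∀ S : Set Ω, ∀ d d' : ℝ, S ∩ {ω | D1 ω = d} ∩ {ω | D0 ω = d'}
      = S ∩ {ω | D1 ω = d ∧ D0 ω = d'} := fun S d d' => by
    rw [Set.inter_assoc]; rfl
  have hset' : ∀ S : Set Ω, ∀ d d' : ℝ, S ∩ {ω | D0 ω = d'} ∩ {ω | D1 ω = d}
      = S ∩ {ω | D1 ω = d ∧ D0 ω = d'} := fun S d d' => by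
    rw [Set.inter_right_comm, hset]
  have hD1 : ∀ S : Set Ω, ∀ d : ℝ, μ.real (S ∩ {ω | D1 ω = d})
      = μ.real (S ∩ {ω | D1 ω = d ∧ D0 ω = 0}) + μ.real (S ∩ {ω | D1 ω = d ∧ D0 ω = 1}) :=
    fun S d => by
      rw [measureReal_split_binary h_meas_D0 h_bin_D0, hset, hset]
  have hD0 : ∀ S : Set Ω, ∀ d : ℝ, μ.real (S ∩ {ω | D0 ω = d})
      = μ.real (S ∩ {ω | D1 ω = 0 ∧ D0 ω = d}) + μ.real (S ∩ {ω | D1 ω = 1 ∧ D0 ω = d}) :=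
    fun S d => by
      rw [measureReal_split_binary h_meas_D1 h_bin_D1, hset', hset']
  have mU : ∀ d d' : ℝ, MeasurableSet {ω | D1 ω = d ∧ D0 ω = d'} := fun d d' =>
    (mD1 d).inter (mD0 d')
  have hU1 : ∀ d d' : ℝ, μ.real {ω | D1 ω = d ∧ D0 ω = d'}
      = μ.real ({ω | Y1 ω = 0} ∩ {ω | D1 ω = d ∧ D0 ω = d'})
        + μ.real ({ω | Y1 ω = 1} ∩ {ω | D1 ω = d ∧ D0 ω = d'}) := fun d d' => by
    rw [measureReal_split_binary h_meas_Y1 h_bin_Y1, Set.inter_comm, Set.inter_comm _ {ω | Y1 ω = 1}]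
  have hU0 : ∀ d d' : ℝ, μ.real {ω | D1 ω = d ∧ D0 ω = d'}
      = μ.real ({ω | Y0 ω = 0} ∩ {ω | D1 ω = d ∧ D0 ω = d'})
        + μ.real ({ω | Y0 ω = 1} ∩ {ω | D1 ω = d ∧ D0 ω = d'}) := fun d d' => by
    rw [measureReal_split_binary h_meas_Y0 h_bin_Y0, Set.inter_comm, Set.inter_comm _ {ω | Y0 ω = 1}]
  change 0 < μ.real _ at h_Ua h_Un h_Uc
  rw [cpr_eq_div (mU 1 1), cpr_eq_div (mU 1 1), div_left_inj' h_Ua.ne', Set.inter_comm,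
    Set.inter_comm _ {ω | Y0 ω = 1}] at h_exclA
  rw [cpr_eq_div (mU 0 0), cpr_eq_div (mU 0 0), div_left_inj' h_Un.ne', Set.inter_comm,
    Set.inter_comm _ {ω | Y0 ω = 1}] at h_exclN
  have hCACE : CACE = (μ.real ({ω | Y1 ω = 1} ∩ {ω | D1 ω = 1 ∧ D0 ω = 0})
      - μ.real ({ω | Y0 ω = 1} ∩ {ω | D1 ω = 1 ∧ D0 ω = 0}))
        / μ.real {ω | D1 ω = 1 ∧ D0 ω = 0} := by
    obtain ⟨i1, e1⟩ := integral_binary (μ := cond μ {ω | D1 ω = 1 ∧ D0 ω = 0}) h_meas_Y1 h_bin_Y1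
    obtain ⟨i0, e0⟩ := integral_binary (μ := cond μ {ω | D1 ω = 1 ∧ D0 ω = 0}) h_meas_Y0 h_bin_Y0
    rw [h_CACE, integral_sub i1 i0, e1, e0]
    change cpr μ _ _ - cpr μ _ _ = _
    rw [cpr_eq_div (mU 1 0), cpr_eq_div (mU 1 0), Set.inter_comm,
      Set.inter_comm _ {ω | Y0 ω = 1}, sub_div]
  obtain ⟨q, hq⟩ : ∃ q, q = cpr μ {ω | D ω = 0} {ω | D' ω = 1} := ⟨_, rfl⟩
  have hSPq : SPD = 1 - q := by
    have hp := hpos (h_posD 0 z0)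
    rw [h_SPD, hq, cpr_eq_div (mD 0), cpr_eq_div (mD 0), eq_sub_iff_add_eq, ← add_div,
      ← measureReal_split_binary h_meas_Dp h_bin_Dp, div_self hp.ne']
  have hq0 : 0 ≤ q := hq ▸ ENNReal.toReal_nonneg
  have hs1 : SND ≤ 1 := by
    rw [h_SND, cpr_eq_div (mD 1)]
    exact div_le_one_of_le₀ (measureReal_mono Set.inter_subset_left) measureReal_nonneg
  -- The observable conditional probabilities.
  have hobs : ∀ z ∈ bin01, ∀ y : ℝ, ∀ A B : ℝ,
      μ.real ({ω | Z ω = z} ∩ {ω | Y ω = y} ∩ {ω | D ω = 1}) = μ.real {ω | Z ω = z} * A →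
      μ.real ({ω | Z ω = z} ∩ {ω | Y ω = y} ∩ {ω | D ω = 0}) = μ.real {ω | Z ω = z} * B →
      cpr μ {ω | Z ω = z} {ω | Y ω = y} = A + B ∧
      cpr μ {ω | Z ω = z} ({ω | Y ω = y} ∩ {ω | D' ω = 1}) = SND * A + q * B ∧
      cpr μ ({ω | Y ω = y} ∩ {ω | Z ω = z}) {ω | D' ω = 1} = (SND * A + q * B) / (A + B) := by
    intro z hz y A B hA hB
    have hp := hpos (h_posZ z hz)
    have e1 : μ.real ({ω | Z ω = z} ∩ {ω | Y ω = y}) = μ.real {ω | Z ω = z} * (A + B) := by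
      rw [measureReal_split_binary h_meas_D h_bin_D, hA, hB]; ring
    have e2 : μ.real ({ω | Z ω = z} ∩ {ω | Y ω = y} ∩ {ω | D' ω = 1})
        = μ.real {ω | Z ω = z} * (SND * A + q * B) := by
      rw [measureReal_split_binary h_meas_D h_bin_D, Set.inter_right_comm _ _ {ω | D ω = 0},
        Set.inter_right_comm _ _ {ω | D ω = 1}, hmis 0 z0 z hz, hmis 1 z1 z hz, hA, hB,
        ← hq, ← h_SND]
      ring
    refine ⟨?_, ?_, ?_⟩
    · rw [cpr_eq_div (mZ z), e1, mul_div_cancel_left₀ _ hp.ne']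
    · rw [cpr_eq_div (mZ z), ← Set.inter_assoc, e2, mul_div_cancel_left₀ _ hp.ne']
    · rw [cpr_eq_div ((mY y).inter (mZ z)), Set.inter_comm {ω | Y ω = y}, e1, e2,
        mul_div_mul_left _ _ hp.ne']
  have hsum : ∀ z : ℝ, cpr μ {ω | Z ω = z} {ω | D' ω = 1}
      = cpr μ {ω | Z ω = z} ({ω | Y ω = 0} ∩ {ω | D' ω = 1})
        + cpr μ {ω | Z ω = z} ({ω | Y ω = 1} ∩ {ω | D' ω = 1}) := fun z => by
    rw [cpr_eq_div (mZ z), cpr_eq_div (mZ z), cpr_eq_div (mZ z),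
      measureReal_split_binary h_meas_Y h_bin_Y, add_div, Set.inter_right_comm,
      Set.inter_right_comm _ _ {ω | Y ω = 1}, Set.inter_assoc, Set.inter_assoc]
  have hYpos : ∀ y ∈ bin01, ∀ z ∈ bin01, 0 < cpr μ {ω | Z ω = z} {ω | Y ω = y} := by
    intro y hy z hz
    rw [cpr_eq_div (mZ z), Set.inter_comm]
    exact div_pos (hpos (h_posYZ y hy z hz)) (hpos (h_posZ z hz))
  have hYsum : ∀ z ∈ bin01,
      cpr μ {ω | Z ω = z} {ω | Y ω = 0} + cpr μ {ω | Z ω = z} {ω | Y ω = 1} = 1 := by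
    intro z hz
    rw [cpr_eq_div (mZ z), cpr_eq_div (mZ z), ← add_div,
      ← measureReal_split_binary h_meas_Y h_bin_Y, div_self (hpos (h_posZ z hz)).ne']
  obtain ⟨o11, t11, c11⟩ := hobs 1 z1 1 _ _ (hprodZ1 1 1) (hprodZ1 1 0)
  obtain ⟨o10, t10, c10⟩ := hobs 1 z1 0 _ _ (hprodZ1 0 1) (hprodZ1 0 0)
  obtain ⟨o01, t01, c01⟩ := hobs 0 z0 1 _ _ (hprodZ0 1 1) (hprodZ0 1 0)
  obtain ⟨o00, t00, c00⟩ := hobs 0 z0 0 _ _ (hprodZ0 0 1) (hprodZ0 0 0)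
  have p11 := hYpos 1 z1 1 z1
  have p10 := hYpos 0 z0 1 z1
  have p01 := hYpos 1 z1 0 z0
  have p00 := hYpos 0 z0 0 z0
  have s1 := hYsum 1 z1
  have s0 := hYsum 0 z0
  have hqs : q ≤ SND := by linarith
  -- Every conditional probability of `D' = 1` lies between `q` and `SND`.
  have k11 := convexCombination_mem_Icc hqs (measureReal_nonneg) (measureReal_nonneg) (o11 ▸ p11)
  have k10 := convexCombination_mem_Icc hqs (measureReal_nonneg) (measureReal_nonneg) (o10 ▸ p10)
  have k01 := convexCombination_mem_Icc hqs (measureReal_nonneg) (measureReal_nonneg) (o01 ▸ p01)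
  have k00 := convexCombination_mem_Icc hqs (measureReal_nonneg) (measureReal_nonneg) (o00 ▸ p00)
  have hmem : ∀ A B A' B' : ℝ, 0 ≤ A → 0 ≤ B → 0 ≤ A' → 0 ≤ B' →
      A + B + (A' + B') = 1 →
      q ≤ SND * A + q * B + (SND * A' + q * B') ∧ SND * A + q * B + (SND * A' + q * B') ≤ SND := by
    intro A B A' B' hA hB hA' hB' h1
    have h := convexCombination_mem_Icc hqs (add_nonneg hA hA') (add_nonneg hB hB') (by linarith)
    rw [show A + A' + (B + B') = 1 by linarith, div_one] at h
    constructor <;> linarith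
  have k1 := hmem _ _ _ _ measureReal_nonneg measureReal_nonneg measureReal_nonneg
    measureReal_nonneg (o10 ▸ o11 ▸ s1)
  have k0 := hmem _ _ _ _ measureReal_nonneg measureReal_nonneg measureReal_nonneg
    measureReal_nonneg (o00 ▸ o01 ▸ s0)
  rw [← t10, ← t11, ← hsum] at k1
  rw [← t00, ← t01, ← hsum] at k0
  rw [← c11] at k11
  rw [← c10] at k10
  rw [← c01] at k01
  rw [← c00] at k00
  have ua1 := hU1 1 1
  have ua0 := hU0 1 1
  have un1 := hU1 0 0
  have un0 := hU0 0 0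
  have uc1 := hU1 1 0
  have uc0 := hU0 1 0
  have exA0 := ua1.symm.trans ua0
  rw [h_exclA, add_left_inj] at exA0
  have exN0 := un1.symm.trans un0
  rw [h_exclN, add_left_inj] at exN0
  have hx1 := measureReal_nonneg (μ := μ) (s := {ω | Y1 ω = 1} ∩ {ω | D1 ω = 1 ∧ D0 ω = 0})
  have hx0 := measureReal_nonneg (μ := μ) (s := {ω | Y1 ω = 0} ∩ {ω | D1 ω = 1 ∧ D0 ω = 0})
  have hw1 := measureReal_nonneg (μ := μ) (s := {ω | Y0 ω = 1} ∩ {ω | D1 ω = 1 ∧ D0 ω = 0})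
  have hw0 := measureReal_nonneg (μ := μ) (s := {ω | Y0 ω = 0} ∩ {ω | D1 ω = 1 ∧ D0 ω = 0})
  simp only [hD1, hD0, hdef, zero_add, add_zero, h_exclA, h_exclN, exA0, exN0]
    at o11 o10 o01 o00 t11 t10 t01 t00
  set x1 := μ.real ({ω | Y1 ω = 1} ∩ {ω | D1 ω = 1 ∧ D0 ω = 0})
  set x0 := μ.real ({ω | Y1 ω = 0} ∩ {ω | D1 ω = 1 ∧ D0 ω = 0})
  set w1 := μ.real ({ω | Y0 ω = 1} ∩ {ω | D1 ω = 1 ∧ D0 ω = 0})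
  set w0 := μ.real ({ω | Y0 ω = 0} ∩ {ω | D1 ω = 1 ∧ D0 ω = 0})
  set γ := μ.real {ω | D1 ω = 1 ∧ D0 ω = 0}
  -- The risk differences in terms of the complier stratum.
  have eY : cpr μ {ω | Z ω = 1} {ω | Y ω = 1} - cpr μ {ω | Z ω = 0} {ω | Y ω = 1} = x1 - w1 := by
    rw [o11, o01]; ring
  have eR1 : cpr μ {ω | Z ω = 1} ({ω | Y ω = 1} ∩ {ω | D' ω = 1})
      - cpr μ {ω | Z ω = 0} ({ω | Y ω = 1} ∩ {ω | D' ω = 1}) = SND * x1 - q * w1 := by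
    rw [t11, t01]; ring
  have eR0 : cpr μ {ω | Z ω = 0} ({ω | Y ω = 0} ∩ {ω | D' ω = 1})
      - cpr μ {ω | Z ω = 1} ({ω | Y ω = 0} ∩ {ω | D' ω = 1}) = q * w0 - SND * x0 := by
    rw [t00, t10]; ring
  have eD : cpr μ {ω | Z ω = 1} {ω | D' ω = 1} - cpr μ {ω | Z ω = 0} {ω | D' ω = 1}
      = (SND - q) * γ := by
    rw [hsum, hsum, t11, t10, t01, t00]
    linear_combination -(SND * uc1) + q * uc0
  rw [eY] at h_RDY h_CACE' h_MD h_ND h_UD h_VD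
  rw [eR1] at h_ND h_UD
  rw [eR0] at h_MD h_VD
  rw [eD] at h_CACE'
  have hr : 0 < SND - q := by linarith
  have ex : x1 - w1 = w0 - x0 := by linarith
  have hM : MD ≤ SND := by
    rw [h_MD]
    refine max_le k0.2 (max_le k1.2 (max_le k10.2 (max_le k11.2 ?_)))
    rw [div_le_iff₀ h_RDY, ex]
    linarith [mul_nonneg hr.le hw0]
  have hU : SND ≤ UD := by
    rw [h_UD]
    refine le_min hs1 ?_
    rw [le_div_iff₀ h_RDY]
    linarith [mul_nonneg hr.le hw1]
  have hN : q ≤ ND := by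
    rw [h_ND]
    refine le_min k0.1 (le_min k1.1 (le_min k00.1 (le_min k01.1 ?_)))
    rw [le_div_iff₀ h_RDY]
    linarith [mul_nonneg hr.le hx1]
  have hV : VD ≤ q := by
    rw [h_VD]
    refine max_le hq0 ?_
    rw [div_le_iff₀ h_RDY, ex]
    linarith [mul_nonneg hr.le hx0]
  have hC : CACE = CACE' * (SND - q) := by
    rw [hCACE, h_CACE']
    field_simp
  have hC' : 0 ≤ CACE' := by
    rw [h_CACE']
    positivity
  refine ⟨hM, hU, by linarith, by linarith, ?_, ?_⟩
  · rw [hC]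
    exact mul_le_mul_of_nonneg_left (by linarith) hC'
  · rw [hC]
    exact mul_le_mul_of_nonneg_left (by linarith) hC'
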